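/- Let t ∈ ℂ and let x₁, x₂, x₃, x₄ ∈ SL(2,ℂ) with tr(xᵢ) = t for all i, such that r₁ = r₂ = r₃ = r₄ where rᵢ = xᵢxᵢ₊₁xᵢ⁻¹xᵢ₋₁xᵢ (subscripts modulo 4), each of the triples (x₁,x₂,x₃), (x₁,x₂,x₄), (x₁,x₃,x₄), (x₂,x₃,x₄) is irreducible, and tr(xᵢxᵢ₊₁) = 1 for all i (subscripts modulo 4). Then t² ≠ 3. -/

import Mathlib

open Matrix

local notation "𝕄" => Matrix (Fin 2) (Fin 2) ℂ
local notation "SL2" => Matrix.SpecialLinearGroup (Fin 2) ℂ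

/-- A family of 2×2 complex matrices is irreducible if there is no nonzero vector
`v ∈ ℂ²` which is a common eigenvector of all members. -/
def IsIrreducibleFamily {ι : Type*} (x : ι → Matrix (Fin 2) (Fin 2) ℂ) : Prop :=
  ¬ ∃ v : Fin 2 → ℂ, v ≠ 0 ∧ ∀ i, ∃ a : ℂ, (x i).mulVec v = a • v

/-- If `a ≠ b` are eigenvalues, an `SL2` element is conjugate within `SL2` to a diagonal one. -/
theorem exists_conj_diag (x : SL2) (t : ℂ) (hx : (x : 𝕄).trace = t) (ht : t ^ 2 = 3) :
    ∃ g : SL2, (g⁻¹ * x * g) 0 1 = 0 ∧ (g⁻¹ * x * g) 1 0 = 0 := by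
  have hdet : x 0 0 * x 1 1 - x 0 1 * x 1 0 = 1 := by
    have := x.det_coe
    rwa [Matrix.det_fin_two] at this
  rw [Matrix.trace_fin_two] at hx
  obtain ⟨s, hs⟩ := IsAlgClosed.exists_pow_nat_eq (t ^ 2 - 4) (n := 2) (by norm_num)
  have hs1 : s ^ 2 = -1 := by rw [hs, ht]; norm_num
  have hs0 : s ≠ 0 := by rintro rfl; norm_num at hs1
  have key : ∀ c : ℂ, c ^ 2 - t * c + 1 = 0 →
      ∃ v : Fin 2 → ℂ, v ≠ 0 ∧ x 0 0 * v 0 + x 0 1 * v 1 = c * v 0 ∧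
        x 1 0 * v 0 + x 1 1 * v 1 = c * v 1 := by
    intro c hc
    have : ((x : 𝕄) - c • (1 : 𝕄)).det = 0 := by
      rw [Matrix.det_fin_two]
      simp
      linear_combination hdet + hc - c * hx
    obtain ⟨v, hv, hv'⟩ := Matrix.exists_mulVec_eq_zero_iff.mpr this
    refine ⟨v, hv, ?_, ?_⟩
    · have := congrFun hv' 0
      simp [Matrix.mulVec, dotProduct, Fin.sum_univ_two] at this
      linear_combination this
    · have := congrFun hv' 1
      simp [Matrix.mulVec, dotProduct, Fin.sum_univ_two] at this
      linear_combination this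
  obtain ⟨v, hv, hv0, hv1⟩ := key ((t + s) / 2) (by linear_combination hs / 4)
  obtain ⟨w, hw, hw0, hw1⟩ := key ((t - s) / 2) (by linear_combination hs / 4)
  have hD : v 0 * w 1 - w 0 * v 1 ≠ 0 := by
    intro hD
    have e0 : ∀ i j : Fin 2, v i * w j = w i * v j := by
      intro i j
      fin_cases i <;> fin_cases j <;> simp <;>
        first | linear_combination (0 : ℂ) * hD | linear_combination hD | linear_combination -hD
    have hz : ∀ i j : Fin 2, v i * w j = 0 := by
      intro i j
      have : s * (v i * w j) = 0 := by
        fin_cases i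
        · have := e0 0 j
          have h0 := e0 1 j
          simp only [Fin.zero_eta, Fin.isValue]
          linear_combination (-w j) * hv0 + v j * hw0 + (x 0 0 - (t - s) / 2) * this + x 0 1 * h0
        · have := e0 0 j
          have h0 := e0 1 j
          simp only [Fin.mk_one, Fin.isValue]
          linear_combination (-w j) * hv1 + v j * hw1 + (x 1 1 - (t - s) / 2) * h0 + x 1 0 * this
      exact (mul_eq_zero.mp this).resolve_left hs0
    obtain ⟨i, hi⟩ := Function.ne_iff.mp hv
    obtain ⟨j, hj⟩ := Function.ne_iff.mp hw
    exact (mul_ne_zero hi hj) (hz i j)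
  set D := v 0 * w 1 - w 0 * v 1 with hDdef
  let g : SL2 := ⟨!![v 0, w 0 / D; v 1, w 1 / D], by
    rw [Matrix.det_fin_two_of]; field_simp; exact hDdef.symm⟩
  have hg : (g : 𝕄) = !![v 0, w 0 / D; v 1, w 1 / D] := rfl
  refine ⟨g, ?_, ?_⟩
  · simp [Matrix.SpecialLinearGroup.coe_inv, Matrix.adjugate_fin_two, hg, Matrix.mul_apply,
      Matrix.vecMul, dotProduct, Fin.sum_univ_two]
    field_simp
    linear_combination w 1 * hw0 - w 0 * hw1
  · simp [Matrix.SpecialLinearGroup.coe_inv, Matrix.adjugate_fin_two, hg, Matrix.mul_apply,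
      Matrix.vecMul, dotProduct, Fin.sum_univ_two]
    linear_combination v 0 * hv1 - v 1 * hv0

/-- Irreducibility is invariant under conjugation. -/
theorem irr_conj (g x y z : SL2) (h : IsIrreducibleFamily ![(x : 𝕄), (y : 𝕄), (z : 𝕄)]) :
    IsIrreducibleFamily ![((g⁻¹ * x * g : SL2) : 𝕄), ((g⁻¹ * y * g : SL2) : 𝕄),
      ((g⁻¹ * z * g : SL2) : 𝕄)] := by
  rintro ⟨v, hv, hi⟩
  have hgv : ∀ u : Fin 2 → ℂ, ((g⁻¹ : SL2) : 𝕄).mulVec ((g : 𝕄).mulVec u) = u := by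
    intro u
    rw [Matrix.mulVec_mulVec, ← Matrix.SpecialLinearGroup.coe_mul]; simp
  have step : ∀ X : SL2, (∃ a : ℂ, ((g⁻¹ * X * g : SL2) : 𝕄).mulVec v = a • v) →
      ∃ a : ℂ, (X : 𝕄).mulVec ((g : 𝕄).mulVec v) = a • ((g : 𝕄).mulVec v) := by
    rintro X ⟨a, ha⟩
    refine ⟨a, ?_⟩
    rw [← Matrix.mulVec_smul, ← ha, Matrix.mulVec_mulVec, Matrix.mulVec_mulVec,
      ← Matrix.SpecialLinearGroup.coe_mul, ← Matrix.SpecialLinearGroup.coe_mul]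
    rw [show g * (g⁻¹ * X * g) = X * g by group]
  refine h ⟨(g : 𝕄).mulVec v, ?_, ?_⟩
  · intro h0
    apply hv
    rw [← hgv v, h0, Matrix.mulVec_zero]
  · intro i
    have := hi i
    fin_cases i
    · exact step x this
    · exact step y this
    · exact step z this

/-- The final algebraic contradiction. -/
theorem final (a b e h f g : ℂ) (hab : a * b = 1) (ht : (a + b) ^ 2 = 3) (htr : e + h = a + b)
    (h1 : e * a + f * g + h * b = 1) (hdet : e * h - f * g = 1) (hf : f ≠ 0) (hg : g ≠ 0) :
    False := by
  have hku : (a - b) * (e - a) = -(f * g) := by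
    linear_combination h1 - b * htr - (ht - 2 * hab)
  have hu : (e - a) ^ 2 = 0 := by
    linear_combination -hdet + e * htr - hku + hab
  have hu0 : e - a = 0 := by simpa using hu
  rw [hu0] at hku
  exact mul_ne_zero hf hg (by linear_combination hku)

theorem eig0 (X : 𝕄) (h : X 1 0 = 0) :
    ∃ a : ℂ, X.mulVec ![1, 0] = a • ![1, 0] := by
  refine ⟨X 0 0, funext (Fin.forall_fin_two.mpr ⟨?_, ?_⟩)⟩
  · change X 0 ⬝ᵥ ![1, 0] = X 0 0 * 1
    rw [dotProduct, Fin.sum_univ_two]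
    change X 0 0 * 1 + X 0 1 * 0 = X 0 0 * 1
    ring
  · change X 1 ⬝ᵥ ![1, 0] = X 0 0 * 0
    rw [dotProduct, Fin.sum_univ_two]
    change X 1 0 * 1 + X 1 1 * 0 = X 0 0 * 0
    rw [h]; ring

theorem eig1 (X : 𝕄) (h : X 0 1 = 0) :
    ∃ a : ℂ, X.mulVec ![0, 1] = a • ![0, 1] := by
  refine ⟨X 1 1, funext (Fin.forall_fin_two.mpr ⟨?_, ?_⟩)⟩
  · change X 0 ⬝ᵥ ![0, 1] = X 1 1 * 0
    rw [dotProduct, Fin.sum_univ_two]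
    change X 0 0 * 0 + X 0 1 * 1 = X 1 1 * 0
    rw [h]; ring
  · change X 1 ⬝ᵥ ![0, 1] = X 1 1 * 1
    rw [dotProduct, Fin.sum_univ_two]
    change X 1 0 * 0 + X 1 1 * 1 = X 1 1 * 1
    ring

theorem conj_rel {G : Type*} [Group G] (g x₁ x₂ x₃ x₄ : G)
    (hr : x₁ * x₂ * x₁⁻¹ * x₄ * x₁ = x₂ * x₃ * x₂⁻¹ * x₁ * x₂) :
    (g⁻¹ * x₁ * g) * (g⁻¹ * x₂ * g) * (g⁻¹ * x₁ * g)⁻¹ * (g⁻¹ * x₄ * g) * (g⁻¹ * x₁ * g) =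
    (g⁻¹ * x₂ * g) * (g⁻¹ * x₃ * g) * (g⁻¹ * x₂ * g)⁻¹ * (g⁻¹ * x₁ * g) * (g⁻¹ * x₂ * g) := by
  calc _ = g⁻¹ * (x₁ * x₂ * x₁⁻¹ * x₄ * x₁) * g := by group
    _ = g⁻¹ * (x₂ * x₃ * x₂⁻¹ * x₁ * x₂) * g := by rw [hr]
    _ = _ := by group

/-- The diagonal case. -/
theorem diag_case (t : ℂ) (x₁ x₂ x₃ x₄ : SL2) (d01 : x₂ 0 1 = 0) (d10 : x₂ 1 0 = 0)
    (hx₁ : ((x₁ : 𝕄)).trace = t) (hx₂ : ((x₂ : 𝕄)).trace = t)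
    (hx₃ : ((x₃ : 𝕄)).trace = t) (hx₄ : ((x₄ : 𝕄)).trace = t)
    (hr₁₂ : x₁ * x₂ * x₁⁻¹ * x₄ * x₁ = x₂ * x₃ * x₂⁻¹ * x₁ * x₂)
    (hirr : IsIrreducibleFamily ![(x₁ : 𝕄), (x₂ : 𝕄), (x₃ : 𝕄)])
    (h₁₂ : ((x₁ * x₂ : SL2) : 𝕄).trace = 1) (h₂₃ : ((x₂ * x₃ : SL2) : 𝕄).trace = 1)
    (h₃₄ : ((x₃ * x₄ : SL2) : 𝕄).trace = 1) (h₄₁ : ((x₄ * x₁ : SL2) : 𝕄).trace = 1)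
    (ht : t ^ 2 = 3) : False := by
  have D1 := x₁.det_coe
  have D2 := x₂.det_coe
  have D3 := x₃.det_coe
  have D4 := x₄.det_coe
  have R10 := congrArg (fun y : SL2 => y 1 0) hr₁₂
  have R01 := congrArg (fun y : SL2 => y 0 1) hr₁₂
  simp only [Matrix.SpecialLinearGroup.coe_mul, Matrix.SpecialLinearGroup.coe_inv,
    Matrix.adjugate_fin_two, Matrix.mul_apply, Fin.sum_univ_two, Matrix.trace_fin_two,
    Matrix.det_fin_two, Matrix.of_apply, Matrix.cons_val', Matrix.cons_val_zero, Matrix.cons_val_one,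
    Matrix.cons_val_fin_one] at D1 D2 D3 D4 R10 R01 hx₁ hx₂ hx₃ hx₄ h₁₂ h₂₃ h₃₄ h₄₁
  have irr0 : ¬ (x₁ 1 0 = 0 ∧ x₃ 1 0 = 0) := by
    rintro ⟨h1, h3⟩
    refine hirr ⟨![1, 0], fun h => one_ne_zero (congrFun h 0), fun i => ?_⟩
    fin_cases i
    · exact eig0 _ h1
    · exact eig0 _ d10
    · exact eig0 _ h3
  have irr1 : ¬ (x₁ 0 1 = 0 ∧ x₃ 0 1 = 0) := by
    rintro ⟨h1, h3⟩
    refine hirr ⟨![0, 1], fun h => one_ne_zero (congrFun h 1), fun i => ?_⟩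
    fin_cases i
    · exact eig1 _ h1
    · exact eig1 _ d01
    · exact eig1 _ h3
  clear hirr hr₁₂
  generalize x₁ 0 0 = p1 at *
  generalize x₁ 0 1 = q1 at *
  generalize x₁ 1 0 = r1 at *
  generalize x₁ 1 1 = s1 at *
  generalize x₂ 0 0 = a at *
  generalize x₂ 1 1 = b at *
  generalize x₂ 0 1 = q2 at *
  generalize x₂ 1 0 = r2 at *
  generalize x₃ 0 0 = p3 at *
  generalize x₃ 0 1 = q3 at *
  generalize x₃ 1 0 = r3 at *
  generalize x₃ 1 1 = s3 at *
  generalize x₄ 0 0 = e at *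
  generalize x₄ 0 1 = f at *
  generalize x₄ 1 0 = g at *
  generalize x₄ 1 1 = h at *
  subst d01 d10
  subst hx₂
  have hab : a * b = 1 := by linear_combination D2
  have hk : (a - b) ^ 2 = -1 := by linear_combination ht - 4 * hab
  have hk0 : a - b ≠ 0 := by intro h0; rw [h0] at hk; norm_num at hk
  have hp1 : p1 = a := by
    apply sub_eq_zero.mp
    refine (mul_eq_zero.mp ?_).resolve_right hk0
    linear_combination h₁₂ - b * hx₁ - ht + 2 * hab
  have hp3 : p3 = a := by
    apply sub_eq_zero.mp
    refine (mul_eq_zero.mp ?_).resolve_right hk0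
    linear_combination h₂₃ - b * hx₃ - ht + 2 * hab
  subst hp1 hp3
  have hs1 : s1 = b := by linear_combination hx₁
  have hs3 : s3 = b := by linear_combination hx₃
  subst hs1 hs3
  have z1 : q1 * r1 = 0 := by linear_combination hab - D1
  have z3 : q3 * r3 = 0 := by linear_combination hab - D3
  rcases mul_eq_zero.mp z1 with hq | hr
  · subst hq
    have hq3 : q3 ≠ 0 := fun h0 => irr1 ⟨rfl, h0⟩
    have hr3 : r3 = 0 := (mul_eq_zero.mp z3).resolve_left hq3
    subst hr3
    have hr1 : r1 ≠ 0 := fun h0 => irr0 ⟨h0, rfl⟩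
    have hf : f = q3 := by
      linear_combination R01 - (f - q3) * (p3 * s3 + 1) * hab
    subst hf
    have hg : g = r1 := by
      apply mul_left_cancel₀ hq3
      linear_combination h₃₄ - h₄₁
    subst hg
    exact final p3 s3 e h f g hab ht hx₄ (by linear_combination h₄₁) D4 hq3 hr1
  · subst hr
    have hr3 : r3 ≠ 0 := fun h0 => irr0 ⟨rfl, h0⟩
    have hq3 : q3 = 0 := (mul_eq_zero.mp z3).resolve_right hr3
    subst hq3
    have hq1 : q1 ≠ 0 := fun h0 => irr1 ⟨h0, rfl⟩
    have hg : g = r3 := by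
      linear_combination R10 - (g - r3) * (p3 * s3 + 1) * hab
    subst hg
    have hf : f = q1 := by
      apply mul_left_cancel₀ hr3
      linear_combination h₃₄ - h₄₁
    subst hf
    exact final p3 s3 e h f g hab ht hx₄ (by linear_combination h₄₁) D4 hq1 hr3

/-- Under the trace equations of 8₁₈ with all triples irreducible
and all `tr(xᵢxᵢ₊₁) = 1`, one has `t² ≠ 3`. -/
theorem stmt19 (t : ℂ) (x₁ x₂ x₃ x₄ : SL2)
    (hx₁ : ((x₁ : 𝕄)).trace = t) (hx₂ : ((x₂ : 𝕄)).trace = t)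
    (hx₃ : ((x₃ : 𝕄)).trace = t) (hx₄ : ((x₄ : 𝕄)).trace = t)
    (hr₁₂ : x₁ * x₂ * x₁⁻¹ * x₄ * x₁ = x₂ * x₃ * x₂⁻¹ * x₁ * x₂)
    (hr₂₃ : x₂ * x₃ * x₂⁻¹ * x₁ * x₂ = x₃ * x₄ * x₃⁻¹ * x₂ * x₃)
    (hr₃₄ : x₃ * x₄ * x₃⁻¹ * x₂ * x₃ = x₄ * x₁ * x₄⁻¹ * x₃ * x₄)
    (hirr₁₂₃ : IsIrreducibleFamily ![(x₁ : 𝕄), (x₂ : 𝕄), (x₃ : 𝕄)])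
    (hirr₁₂₄ : IsIrreducibleFamily ![(x₁ : 𝕄), (x₂ : 𝕄), (x₄ : 𝕄)])
    (hirr₁₃₄ : IsIrreducibleFamily ![(x₁ : 𝕄), (x₃ : 𝕄), (x₄ : 𝕄)])
    (hirr₂₃₄ : IsIrreducibleFamily ![(x₂ : 𝕄), (x₃ : 𝕄), (x₄ : 𝕄)])
    (h₁₂ : ((x₁ * x₂ : SL2) : 𝕄).trace = 1) (h₂₃ : ((x₂ * x₃ : SL2) : 𝕄).trace = 1)
    (h₃₄ : ((x₃ * x₄ : SL2) : 𝕄).trace = 1) (h₄₁ : ((x₄ * x₁ : SL2) : 𝕄).trace = 1) :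
    t ^ 2 ≠ 3 := by
  intro ht
  obtain ⟨g, h01, h10⟩ := exists_conj_diag x₂ t hx₂ ht
  have tr : ∀ X : SL2, ((g⁻¹ * X * g : SL2) : 𝕄).trace = (X : 𝕄).trace := by
    intro X
    rw [Matrix.SpecialLinearGroup.coe_mul, Matrix.trace_mul_comm,
      ← Matrix.SpecialLinearGroup.coe_mul]
    rw [show g * (g⁻¹ * X) = X by group]
  have tr2 : ∀ X Y : SL2, (((g⁻¹ * X * g) * (g⁻¹ * Y * g) : SL2) : 𝕄).trace
      = ((X * Y : SL2) : 𝕄).trace := by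
    intro X Y
    rw [← tr (X * Y), show (g⁻¹ * X * g) * (g⁻¹ * Y * g) = g⁻¹ * (X * Y) * g by group]
  refine diag_case t (g⁻¹ * x₁ * g) (g⁻¹ * x₂ * g) (g⁻¹ * x₃ * g) (g⁻¹ * x₄ * g) h01 h10
    ((tr _).trans hx₁) ((tr _).trans hx₂) ((tr _).trans hx₃) ((tr _).trans hx₄) ?_
    (irr_conj g _ _ _ hirr₁₂₃) ((tr2 _ _).trans h₁₂) ((tr2 _ _).trans h₂₃)
    ((tr2 _ _).trans h₃₄) ((tr2 _ _).trans h₄₁) ht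
  exact conj_rel g x₁ x₂ x₃ x₄ hr₁₂
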